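/- Let (X,d) be a separable metric space directionally (ξ,η,ζ)-limited at X and endowed with an asymptotically (α,γ)-bounded Borel measure ν (α ∈ (0,1], γ ≥ 1). Let μ = μ⁺ − μ⁻ be a signed Borel measure on X, where μ⁺, μ⁻ are mutually singular positive Borel measures finite on bounded sets. Let q₊, q₋ be premeasures on closed balls satisfying, for some C ≥ 1, all x ∈ X and r > 0: (1/C) μ⁺(B_{αr}(x)) − μ⁻(B_r(x)) ≤ q₊(B_r(x)) ≤ C μ⁺(B_r(x)) and (1/C) μ⁻(B_{αr}(x)) − μ⁺(B_r(x)) ≤ q₋(B_r(x)) ≤ C μ⁻(B_r(x)). Then: (i) the packing constructions ĥμ^{q₊} and ĥμ^{q₋} are metric outer measures finite on bounded sets; (ii) for every Borel set A ⊂ X, (1/(γC)) μ⁺(A) ≤ ĥμ^{q₊}(A) ≤ C μ⁺(A) and (1/(γC)) μ⁻(A) ≤ ĥμ^{q₋}(A) ≤ C μ⁻(A); in particular (1/(γC)) (μ⁺+μ⁻)(A) ≤ (ĥμ^{q₊}+ĥμ^{q₋})(A) ≤ C (μ⁺+μ⁻)(A). -/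

import Mathlib

open MeasureTheory Metric Set Filter Topology ENNReal Bornology

/-- `(X,d)` is directionally `(ξ,η,ζ)`-limited at `A`: for every `a ∈ A` and every
`B ⊆ A ∩ (U_ξ(a) \ {a})` such that for all distinct `b, c ∈ B` with `d(a,b) ≥ d(a,c)`,
every `x` with `d(a,x) = d(a,c)` and `d(a,x) + d(x,b) = d(a,b)` satisfies
`d(x,c)/d(a,c) ≥ η`, the set `B` has cardinality at most `ζ`. -/
def DirLimited {X : Type*} [MetricSpace X] (A : Set X) (ξ η : ℝ) (ζ : ℕ) : Prop :=
  ∀ a ∈ A, ∀ B : Set X, B ⊆ A ∩ (Metric.ball a ξ \ {a}) →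
    (∀ b ∈ B, ∀ c ∈ B, b ≠ c → dist a c ≤ dist a b →
      ∀ x : X, dist a x = dist a c → dist a x + dist x b = dist a b →
        η ≤ dist x c / dist a c) →
    B.Finite ∧ B.ncard ≤ ζ
/-- `ν` is asymptotically `(α,γ)`-bounded: finite on bounded sets, strictly positive on
balls of positive radius, and `limsup_{r→0⁺} ν(B_r(x))/ν(B_{αr}(x)) ≤ γ` for all `x`. -/
def AsympBounded {X : Type*} [MetricSpace X] [MeasurableSpace X]
    (ν : MeasureTheory.Measure X) (α γ : ℝ) : Prop :=
  (∀ s : Set X, Bornology.IsBounded s → ν s < ⊤) ∧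
  (∀ (x : X) (r : ℝ), 0 < r → 0 < ν (Metric.closedBall x r)) ∧
  (∀ x : X, Filter.limsup
      (fun r : ℝ => ν (Metric.closedBall x r) / ν (Metric.closedBall x (α * r)))
      (nhdsWithin 0 (Set.Ioi 0)) ≤ ENNReal.ofReal γ)
/-- A packing of the open set `U` of order `δ`: a countable family of pairwise disjoint
closed balls, each of positive radius at most `δ` and contained in `U`, encoded as a
countable set of (center, radius) pairs. -/
def IsPackingOf {X : Type*} [MetricSpace X] (U : Set X) (δ : ℝ) (P : Set (X × ℝ)) : Prop :=
  P.Countable ∧ (∀ p ∈ P, 0 < p.2 ∧ p.2 ≤ δ ∧ Metric.closedBall p.1 p.2 ⊆ U) ∧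
  P.Pairwise fun p p' => Disjoint (Metric.closedBall p.1 p.2) (Metric.closedBall p'.1 p'.2)

/-- `ĥμ^q_δ(U)`: supremum of `∑_{B ∈ ℱ} q(B)` over packings `ℱ` of `U` of order `δ`. -/
noncomputable def packPre {X : Type*} [MetricSpace X] (q : X → ℝ → ℝ≥0∞) (δ : ℝ)
    (U : Set X) : ℝ≥0∞ :=
  ⨆ (P : Set (X × ℝ)) (_ : IsPackingOf U δ P), ∑' p : P, q p.1.1 p.1.2

/-- `ĥμ^q(U) = inf_{δ>0} ĥμ^q_δ(U)` for `U` open. -/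
noncomputable def packOpen {X : Type*} [MetricSpace X] (q : X → ℝ → ℝ≥0∞)
    (U : Set X) : ℝ≥0∞ :=
  ⨅ (δ : ℝ) (_ : 0 < δ), packPre q δ U

/-- The packing construction extended to arbitrary sets:
`ĥμ^q(A) = inf { ĥμ^q(U) : A ⊆ U, U open }`. -/
noncomputable def packM {X : Type*} [MetricSpace X] (q : X → ℝ → ℝ≥0∞)
    (A : Set X) : ℝ≥0∞ :=
  ⨅ (U : Set X) (_ : IsOpen U) (_ : A ⊆ U), packOpen q U

/-- In a directionally limited space, the points of a sufficiently small subset cannot be the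
centers of arbitrarily large Besicovitch satellite configurations. -/
theorem DirLimited.hasBesicovitchCovering {X : Type*} [MetricSpace X] {ξ η : ℝ} {ζ : ℕ}
    (hη : η ≤ 1 / 3) (hdir : DirLimited (univ : Set X) ξ η ζ) {V : Set X}
    (hV : ∀ x ∈ V, ∀ y ∈ V, dist x y < ξ) : HasBesicovitchCovering V := by
  classical
  refine ⟨37 * ζ + 1, 7 / 6, by norm_num, ⟨fun S => ?_⟩⟩
  set N := 37 * ζ + 1 with hN
  set a : X := (S.c (Fin.last N) : X) with ha
  set R : ℝ := S.r (Fin.last N) with hR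
  have hRpos : 0 < R := S.rpos _
  let c : Fin N → X := fun i => (S.c i.castSucc : X)
  let r : Fin N → ℝ := fun i => S.r i.castSucc
  have hrpos : ∀ i, 0 < r i := fun i => S.rpos _
  have hlast : ∀ i, r i ≤ dist a (c i) ∧ R ≤ 7 / 6 * r i := fun i => by
    have := S.hlast i.castSucc (Fin.castSucc_lt_last i)
    rwa [dist_comm] at this
  have hinter : ∀ i, dist a (c i) ≤ r i + R := fun i => by
    have := S.inter i.castSucc (Fin.castSucc_lt_last i)
    rwa [dist_comm] at this
  have hsep : ∀ i j, i ≠ j → (r i ≤ dist (c i) (c j) ∧ r j ≤ 7 / 6 * r i) ∨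
      (r j ≤ dist (c i) (c j) ∧ r i ≤ 7 / 6 * r j) := fun i j hij => by
    have := S.h (i := i.castSucc) (j := j.castSucc)
      (fun h => hij (Fin.castSucc_injective _ h))
    simp only [dist_comm (S.c j.castSucc)] at this
    exact this
  have hinj : Function.Injective c := fun i j hij => by
    by_contra hne
    have := hsep i j hne
    rw [hij, dist_self] at this
    have hi := hrpos i
    have hj := hrpos j
    rcases this with h | h <;> linarith
  let k : Fin N → ℕ := fun i => min ⌊12 * dist a (c i) / R⌋₊ 36
  obtain ⟨m, -, hm⟩ := Finset.exists_lt_card_fiber_of_mul_lt_card_of_maps_to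
    (s := Finset.univ) (t := Finset.range 37) (f := k) (n := ζ)
    (fun i _ => by simp only [k, Finset.mem_range]; omega) (by simp [hN])
  let s : Finset X := ({x ∈ (Finset.univ : Finset (Fin N)) | k x = m}).image c
  have hs : ζ < s.card := by rwa [Finset.card_image_of_injective _ hinj]
  have key : (s : Set X).Finite ∧ (s : Set X).ncard ≤ ζ := by
    refine hdir a (mem_univ _) s ?_ ?_
    · intro x hx
      simp only [s, Finset.coe_image, Set.mem_image] at hx
      obtain ⟨i, -, rfl⟩ := hx
      refine ⟨mem_univ _, ?_, ?_⟩
      · rw [mem_ball]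
        exact hV _ (S.c i.castSucc).2 _ (S.c (Fin.last N)).2
      · intro h
        rw [mem_singleton_iff] at h
        have h1 := (hlast i).1
        rw [h, dist_self] at h1
        exact absurd (hrpos i) (not_lt.2 h1)
    · intro b hb c' hc' hbc hle x hx1 hx2
      simp only [s, Finset.coe_image, Set.mem_image, Finset.coe_filter, Finset.mem_univ, true_and,
        mem_ofPred_eq] at hb hc'
      obtain ⟨i, hi, rfl⟩ := hb
      obtain ⟨j, hj, rfl⟩ := hc'
      have hij : i ≠ j := fun h => hbc (by rw [h])
      have hi1 := hlast i
      have hj1 := hlast j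
      have hi2 := hinter i
      have hj2 := hinter j
      have hij' := hsep i j hij
      have hrj := hrpos j
      have hri := hrpos i
      have tri : dist (c i) (c j) ≤ dist x (c i) + dist x (c j) := by
        rw [dist_comm x (c i)]; exact dist_triangle _ _ _
      rw [le_div_iff₀ (hrj.trans_le hj1.1)]
      have hη3 : η * dist a (c j) ≤ 1 / 3 * dist a (c j) :=
        mul_le_mul_of_nonneg_right hη dist_nonneg
      refine hη3.trans ?_
      by_cases hfar : 3 * R ≤ dist a (c j)
      · rcases hij' with h | h <;> linarith
      · have hkj : ⌊12 * dist a (c j) / R⌋₊ < 36 := by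
          rw [Nat.floor_lt (by positivity), div_lt_iff₀ hRpos]
          push_cast; linarith
        have hki : ⌊12 * dist a (c i) / R⌋₊ = ⌊12 * dist a (c j) / R⌋₊ := by
          simp only [k] at hi hj; omega
        have h1 := Nat.lt_floor_add_one (12 * dist a (c i) / R)
        have h2 := Nat.floor_le (a := 12 * dist a (c j) / R) (by positivity)
        rw [hki] at h1
        have h3 : 12 * dist a (c i) / R < 12 * dist a (c j) / R + 1 := by linarith
        rw [div_lt_iff₀ hRpos, add_mul, div_mul_cancel₀ _ hRpos.ne'] at h3
        rcases hij' with h | h <;> linarith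
  rw [Set.ncard_coe_finset] at key
  omega

/-- If `ν` is asymptotically bounded with constant `γ < γ'`, then any finite measure `μ` satisfies
the doubling-type inequality with constant `γ'` at arbitrarily small scales, at `μ`-almost every
point. -/
theorem frequently_measure_closedBall_le_mul {Y : Type*} [MetricSpace Y] [MeasurableSpace Y]
    [BorelSpace Y] [SecondCountableTopology Y] [HasBesicovitchCovering Y]
    (μ ν : Measure Y) [IsFiniteMeasure μ] [IsFiniteMeasure ν] {α γ γ' : ℝ} (hα : 0 < α)
    (hα1 : α ≤ 1) (hγ : 0 < γ) (hγγ' : γ < γ')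
    (hνpos : ∀ (x : Y) (r : ℝ), 0 < r → 0 < ν (closedBall x r))
    (hνlim : ∀ x : Y, limsup (fun r : ℝ => ν (closedBall x r) / ν (closedBall x (α * r))) (𝓝[>] 0)
      ≤ ENNReal.ofReal γ) :
    ∀ᵐ x ∂μ, ∃ᶠ r in 𝓝[>] (0 : ℝ),
      μ (closedBall x r) ≤ ENNReal.ofReal γ' * μ (closedBall x (α * r)) := by
  filter_upwards [Besicovitch.ae_tendsto_rnDeriv ν μ, ν.rnDeriv_lt_top μ] with x hx hxtop
  intro hcon
  obtain ⟨g, hγg, hgγ'⟩ := exists_between hγγ'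
  have hg : 0 < g := hγ.trans hγg
  have hν : ∀ᶠ r in 𝓝[>] (0 : ℝ),
      ν (closedBall x r) ≤ ENNReal.ofReal g * ν (closedBall x (α * r)) := by
    have h1 := eventually_lt_of_limsup_lt
      ((hνlim x).trans_lt ((ENNReal.ofReal_lt_ofReal_iff hg).2 hγg))
    filter_upwards [h1, self_mem_nhdsWithin] with r hr hr0
    refine (ENNReal.div_le_iff ?_ (measure_ne_top _ _)).1 hr.le
    exact (hνpos x _ (mul_pos hα hr0)).ne'
  obtain ⟨M, hM1, hM2⟩ := exists_between hxtop
  have hνμ : ∀ᶠ r in 𝓝[>] (0 : ℝ), ν (closedBall x r) ≤ M * μ (closedBall x r) := by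
    filter_upwards [hx.eventually_lt_const hM1] with r hr
    by_cases h0 : μ (closedBall x r) = 0
    · rcases eq_or_ne (ν (closedBall x r)) 0 with h | h
      · simp [h]
      · rw [h0, ENNReal.div_zero h] at hr
        exact absurd hr not_top_lt
    · exact (ENNReal.div_le_iff h0 (measure_ne_top _ _)).1 hr.le
  obtain ⟨ρ, hρ, hall⟩ := mem_nhdsGT_iff_exists_Ioc_subset.1 ((hcon.and hν).and hνμ)
  rw [Set.mem_Ioi] at hρ
  have hmem : ∀ k : ℕ, α ^ k * ρ ∈ Ioc 0 ρ := fun k =>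
    ⟨by positivity, mul_le_of_le_one_left hρ.le (pow_le_one₀ hα.le hα1)⟩
  have hμk : ∀ k : ℕ, ENNReal.ofReal γ' ^ k * μ (closedBall x (α ^ k * ρ)) ≤
      μ (closedBall x ρ) := by
    intro k
    induction k with
    | zero => simp
    | succ k ih =>
      refine le_trans ?_ ih
      have := (hall (hmem k)).1.1
      rw [not_le] at this
      rw [pow_succ, mul_assoc, pow_succ', mul_assoc α]
      gcongr
  have hνk : ∀ k : ℕ, ν (closedBall x ρ) ≤
      ENNReal.ofReal g ^ k * ν (closedBall x (α ^ k * ρ)) := by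
    intro k
    induction k with
    | zero => simp
    | succ k ih =>
      refine ih.trans ?_
      have := (hall (hmem k)).1.2
      rw [pow_succ, mul_assoc, pow_succ', mul_assoc α]
      gcongr
  have hk : ∀ k : ℕ, γ' ^ k * ν.real (closedBall x ρ) ≤
      g ^ k * (M.toReal * μ.real (closedBall x ρ)) := by
    intro k
    have h : ENNReal.ofReal γ' ^ k * ν (closedBall x ρ) ≤
        ENNReal.ofReal g ^ k * (M * μ (closedBall x ρ)) := by
      calc ENNReal.ofReal γ' ^ k * ν (closedBall x ρ)
          ≤ ENNReal.ofReal γ' ^ k *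
            (ENNReal.ofReal g ^ k * (M * μ (closedBall x (α ^ k * ρ)))) := by
            gcongr
            exact (hνk k).trans (by gcongr; exact (hall (hmem k)).2)
        _ = ENNReal.ofReal g ^ k * (M * (ENNReal.ofReal γ' ^ k *
              μ (closedBall x (α ^ k * ρ)))) := by ring
        _ ≤ _ := by gcongr; exact hμk k
    have h' := ENNReal.toReal_mono (by finiteness) h
    simpa [ENNReal.toReal_mul, ENNReal.toReal_pow, ENNReal.toReal_ofReal, hg.le,
      (hg.trans hgγ').le, Measure.real] using h'
  have hlim : Tendsto (fun k : ℕ => (g / γ') ^ k * (M.toReal * μ.real (closedBall x ρ))) atTop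
      (𝓝 (0 * (M.toReal * μ.real (closedBall x ρ)))) :=
    (tendsto_pow_atTop_nhds_zero_of_lt_one (div_nonneg hg.le (hg.trans hgγ').le)
      ((div_lt_one (hg.trans hgγ')).2 hgγ')).mul_const _
  have hle : ν.real (closedBall x ρ) ≤ 0 * (M.toReal * μ.real (closedBall x ρ)) := by
    refine ge_of_tendsto' hlim fun k => ?_
    have hpos : 0 < γ' ^ k := pow_pos (hg.trans hgγ') k
    rw [div_pow, div_mul_eq_mul_div, le_div_iff₀ hpos, mul_comm]
    exact hk k
  rw [zero_mul] at hle
  exact absurd hle (not_le.2 (ENNReal.toReal_pos (hνpos x ρ hρ).ne' (measure_ne_top _ _)))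

/-- At almost every point, a lower bound of the premeasure `q` in terms of mutually singular
measures `μ` and `m` improves, at arbitrarily small scales, to a lower bound involving only `μ`
and balls of the same radius. -/
theorem frequently_mul_measure_closedBall_le {Y : Type*} [MetricSpace Y] [MeasurableSpace Y]
    [BorelSpace Y] [SecondCountableTopology Y] [HasBesicovitchCovering Y]
    (μ m ν : Measure Y) [IsFiniteMeasure μ] [IsFiniteMeasure m] [IsFiniteMeasure ν]
    (hsing : m.MutuallySingular μ) {α γ C ε : ℝ} (hα : 0 < α)
    (hα1 : α ≤ 1) (hγ : 1 ≤ γ) (hC : 1 ≤ C) (hε : 0 < ε)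
    (hνpos : ∀ (x : Y) (r : ℝ), 0 < r → 0 < ν (closedBall x r))
    (hνlim : ∀ x : Y, limsup (fun r : ℝ => ν (closedBall x r) / ν (closedBall x (α * r))) (𝓝[>] 0)
      ≤ ENNReal.ofReal γ)
    (q : Y → ℝ → ℝ≥0∞)
    (hq : ∀ x, ∀ᶠ r in 𝓝[>] (0 : ℝ),
      ENNReal.ofReal (1 / C) * μ (closedBall x (α * r)) ≤ q x r + m (closedBall x r)) :
    ∀ᵐ x ∂μ, ∃ᶠ r in 𝓝[>] (0 : ℝ),
      ENNReal.ofReal (1 / (γ * C)) * μ (closedBall x r) ≤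
        q x r + ENNReal.ofReal (2 * ε) * μ (closedBall x r) := by
  have hγ0 : 0 < γ := by linarith
  have hC0 : 0 < C := by linarith
  have hγ' : γ < γ * (1 + ε) := by nlinarith
  filter_upwards [frequently_measure_closedBall_le_mul μ ν hα hα1 hγ0 hγ' hνpos hνlim,
    Besicovitch.ae_tendsto_rnDeriv m μ, hsing.rnDeriv_ae_eq_zero] with x hx1 hx2 hx3
  rw [hx3] at hx2
  have hm : ∀ᶠ r in 𝓝[>] (0 : ℝ), m (closedBall x r) ≤ ENNReal.ofReal ε * μ (closedBall x r) := by
    filter_upwards [hx2.eventually_lt_const (ENNReal.ofReal_pos.2 hε)] with r hr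
    by_cases h0 : μ (closedBall x r) = 0
    · rcases eq_or_ne (m (closedBall x r)) 0 with h | h
      · simp [h]
      · rw [h0, ENNReal.div_zero h] at hr
        exact absurd hr not_top_lt
    · exact (ENNReal.div_le_iff h0 (measure_ne_top _ _)).1 hr.le
  refine (hx1.and_eventually (hm.and (hq x))).mono ?_
  rintro r ⟨h1, h2, h3⟩
  have hreal : 1 / (γ * C) ≤ 1 / C * (1 / (γ * (1 + ε))) + ε := by
    have e1 : 1 / (γ * C) - 1 / C * (1 / (γ * (1 + ε))) = ε / (γ * C * (1 + ε)) := by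
      field_simp
      ring
    have e2 : ε / (γ * C * (1 + ε)) ≤ ε := by
      refine div_le_self hε.le ?_
      have : 1 ≤ γ * C := one_le_mul_of_one_le_of_one_le hγ hC
      nlinarith
    linarith
  calc ENNReal.ofReal (1 / (γ * C)) * μ (closedBall x r)
      ≤ ENNReal.ofReal (1 / C * (1 / (γ * (1 + ε))) + ε) * μ (closedBall x r) := by gcongr
    _ = ENNReal.ofReal (1 / C) * (ENNReal.ofReal (1 / (γ * (1 + ε))) * μ (closedBall x r)) +
          ENNReal.ofReal ε * μ (closedBall x r) := by
        rw [ENNReal.ofReal_add (by positivity) hε.le, ENNReal.ofReal_mul (by positivity), add_mul,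
          mul_assoc]
    _ ≤ ENNReal.ofReal (1 / C) * μ (closedBall x (α * r)) +
          ENNReal.ofReal ε * μ (closedBall x r) := by
        gcongr
        rw [one_div, ENNReal.ofReal_inv_of_pos (by positivity)]
        exact (ENNReal.inv_mul_le_iff (by simp; positivity) (by finiteness)).2 h1
    _ ≤ q x r + ENNReal.ofReal ε * μ (closedBall x r) + ENNReal.ofReal ε * μ (closedBall x r) := by
        gcongr
        exact h3.trans (by gcongr)
    _ = q x r + ENNReal.ofReal (2 * ε) * μ (closedBall x r) := by
        rw [two_mul, ENNReal.ofReal_add hε.le hε.le, add_mul, add_assoc]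

/-- In a small open set, the packing premeasure at any scale dominates a multiple of `μ`. -/
theorem mul_measure_le_packPre_of_dist_lt {X : Type*} [MetricSpace X] [MeasurableSpace X]
    [BorelSpace X] [TopologicalSpace.SeparableSpace X] {ξ η : ℝ} {ζ : ℕ} (hη : η ≤ 1 / 3)
    (hdir : DirLimited (univ : Set X) ξ η ζ) {ν μ m : Measure X} {α γ C : ℝ} (hα : 0 < α)
    (hα1 : α ≤ 1) (hγ : 1 ≤ γ) (hC : 1 ≤ C) (hν : AsympBounded ν α γ)
    (hsing : m.MutuallySingular μ)
    (hμ : ∀ s : Set X, IsBounded s → μ s < ⊤) (hm : ∀ s : Set X, IsBounded s → m s < ⊤)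
    {q : X → ℝ → ℝ≥0∞}
    (hq : ∀ (x : X) (r : ℝ), 0 < r →
      ENNReal.ofReal (1 / C) * μ (closedBall x (α * r)) ≤ q x r + m (closedBall x r))
    {V : Set X} (hVo : IsOpen V) (hV : ∀ x ∈ V, ∀ y ∈ V, dist x y < ξ) {δ : ℝ} (hδ : 0 < δ) :
    ENNReal.ofReal (1 / (γ * C)) * μ V ≤ packPre q δ V := by
  have : SecondCountableTopology X := UniformSpace.secondCountable_of_separable X
  have : HasBesicovitchCovering V := hdir.hasBesicovitchCovering hη hV
  have hbdd : IsBounded V := isBounded_iff.2 ⟨ξ, fun x hx y hy => (hV x hx y hy).le⟩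
  have hcomap : ∀ (ρ : Measure X) (s : Set V), ρ.comap Subtype.val s = ρ (Subtype.val '' s) :=
    comap_subtype_coe_apply hVo.measurableSet
  have hfin : ∀ ρ : Measure X, (∀ s, IsBounded s → ρ s < ⊤) →
      IsFiniteMeasure (ρ.comap (Subtype.val : V → X)) := fun ρ hρ =>
    ⟨by rw [hcomap, image_univ, Subtype.range_coe]; exact hρ V hbdd⟩
  have := hfin μ hμ
  have := hfin m hm
  have := hfin ν hν.1
  have hR : ∀ x : V, ∃ R > 0, closedBall (x : X) R ⊆ V := fun x =>
    nhds_basis_closedBall.mem_iff.1 (hVo.mem_nhds x.2)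
  choose R hR0 hRV using hR
  have himage : ∀ (x : V) (r : ℝ), r ≤ R x →
      Subtype.val '' closedBall x r = closedBall (x : X) r := fun x r hr => by
    rw [Subtype.image_closedBall]
    exact inter_eq_left.2 ((closedBall_subset_closedBall hr).trans (hRV x))
  have hball : ∀ (ρ : Measure X) (x : V) (r : ℝ), r ≤ R x →
      ρ.comap Subtype.val (closedBall x r) = ρ (closedBall (x : X) r) := fun ρ x r hr => by
    rw [hcomap, himage x r hr]
  have hsmall : ∀ x : V, ∀ᶠ r in 𝓝[>] (0 : ℝ), 0 < r ∧ r ≤ R x ∧ α * r ≤ R x := fun x => by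
    filter_upwards [Ioc_mem_nhdsGT (hR0 x)] with r hr
    exact ⟨hr.1, hr.2, (mul_le_of_le_one_left hr.1.le hα1).trans hr.2⟩
  have hνpos : ∀ (x : V) (r : ℝ), 0 < r → 0 < ν.comap Subtype.val (closedBall x r) := by
    intro x r hr
    refine lt_of_lt_of_le ?_ (measure_mono (closedBall_subset_closedBall (min_le_left r (R x))))
    rw [hball ν x _ (min_le_right _ _)]
    exact hν.2.1 _ _ (lt_min hr (hR0 x))
  have hνlim : ∀ x : V, limsup (fun r : ℝ => ν.comap Subtype.val (closedBall x r) /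
      ν.comap Subtype.val (closedBall x (α * r))) (𝓝[>] 0) ≤ ENNReal.ofReal γ := by
    intro x
    refine le_of_eq_of_le (limsup_congr ?_) (hν.2.2 x)
    filter_upwards [hsmall x] with r hr
    rw [hball ν x r hr.2.1, hball ν x _ hr.2.2]
  have hsing' : (m.comap (Subtype.val : V → X)).MutuallySingular (μ.comap Subtype.val) := by
    obtain ⟨s, hs, hs1, hs2⟩ := hsing
    refine ⟨Subtype.val ⁻¹' s, measurable_subtype_coe hs, ?_, ?_⟩
    · rw [hcomap]
      exact measure_mono_null (image_preimage_subset _ _) hs1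
    · rw [hcomap, ← preimage_compl]
      exact measure_mono_null (image_preimage_subset _ _) hs2
  have hbound : ∀ ε : ℝ, 0 < ε → ENNReal.ofReal (1 / (γ * C)) * μ V ≤
      packPre q δ V + ENNReal.ofReal (2 * ε) * μ V := by
    intro ε hε
    have hae := frequently_mul_measure_closedBall_le (μ.comap (Subtype.val : V → X))
      (m.comap Subtype.val) (ν.comap Subtype.val) hsing' hα hα1 hγ hC hε hνpos hνlim
      (fun x r => q x r) (fun x => by
        filter_upwards [hsmall x] with r hr
        rw [hball μ x _ hr.2.2, hball m x _ hr.2.1]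
        exact hq x r hr.1)
    set μ' := μ.comap (Subtype.val : V → X) with hμ'
    let f : V → Set ℝ := fun x => {r | ENNReal.ofReal (1 / (γ * C)) * μ' (closedBall x r) ≤
      q x r + ENNReal.ofReal (2 * ε) * μ' (closedBall x r)}
    obtain ⟨t, r, htc, -, htr, hcover, hdisj⟩ := Besicovitch.exists_disjoint_closedBall_covering_ae
      μ' f {x | ∃ᶠ r in 𝓝[>] (0 : ℝ), r ∈ f x} (fun x hx δ' hδ' => by
        obtain ⟨r, hr1, hr2⟩ := (Filter.Frequently.and_eventually hx (Ioo_mem_nhdsGT hδ')).exists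
        exact ⟨r, hr1, hr2⟩) (fun x => min δ (R x)) (fun x _ => lt_min hδ (hR0 x))
    have hμV : μ' univ = μ V := by rw [hcomap, image_univ, Subtype.range_coe]
    have hcov : μ' univ ≤ μ' (⋃ x ∈ t, closedBall x (r x)) := by
      refine measure_mono_ae ?_
      have hnull : ∀ᵐ x ∂μ', x ∉ {x | ∃ᶠ r in 𝓝[>] (0 : ℝ), r ∈ f x} \
          ⋃ x ∈ t, closedBall x (r x) := measure_eq_zero_iff_ae_notMem.1 hcover
      filter_upwards [hae, hnull] with x hx1 hx2 _
      by_contra h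
      exact hx2 ⟨hx1, h⟩
    have hrle : ∀ x ∈ t, 0 < r x ∧ r x ≤ δ ∧ r x ≤ R x := fun x hx =>
      ⟨(htr x hx).2.1, (htr x hx).2.2.le.trans (min_le_left _ _),
        (htr x hx).2.2.le.trans (min_le_right _ _)⟩
    have hmeas : μ' (⋃ x ∈ t, closedBall x (r x)) = ∑' x : t, μ' (closedBall (x : V) (r x)) :=
      measure_biUnion htc hdisj fun x _ => isClosed_closedBall.measurableSet
    let φ : V → X × ℝ := fun x => (x, r x)
    have hφ : Function.Injective φ := fun x y h => Subtype.ext (congrArg Prod.fst h)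
    have hpack : IsPackingOf V δ (φ '' t) := by
      refine ⟨htc.image _, ?_, ?_⟩
      · rintro _ ⟨x, hx, rfl⟩
        obtain ⟨h1, h2, h3⟩ := hrle x hx
        exact ⟨h1, h2, (closedBall_subset_closedBall h3).trans (hRV x)⟩
      · rintro _ ⟨x, hx, rfl⟩ _ ⟨y, hy, rfl⟩ hxy
        have := hdisj hx hy fun h => hxy (by rw [h])
        have := (disjoint_image_iff Subtype.val_injective).2 this
        rwa [himage x _ (hrle x hx).2.2, himage y _ (hrle y hy).2.2] at this
    have hsum : ∑' x : t, q (x : V) (r x) ≤ packPre q δ V := by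
      have := le_iSup₂ (f := fun (P : Set (X × ℝ)) (_ : IsPackingOf V δ P) =>
        ∑' p : P, q p.1.1 p.1.2) _ hpack
      rwa [tsum_image (fun p : X × ℝ => q p.1 p.2) hφ.injOn] at this
    calc ENNReal.ofReal (1 / (γ * C)) * μ V
        ≤ ENNReal.ofReal (1 / (γ * C)) * ∑' x : t, μ' (closedBall (x : V) (r x)) := by
          rw [← hμV, ← hmeas]
          gcongr
      _ = ∑' x : t, ENNReal.ofReal (1 / (γ * C)) * μ' (closedBall (x : V) (r x)) :=
          ENNReal.tsum_mul_left.symm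
      _ ≤ ∑' x : t, (q (x : V) (r x) + ENNReal.ofReal (2 * ε) * μ' (closedBall (x : V) (r x))) :=
          ENNReal.tsum_le_tsum fun x => (htr x x.2).1
      _ = ∑' x : t, q (x : V) (r x) +
            ENNReal.ofReal (2 * ε) * μ' (⋃ x ∈ t, closedBall x (r x)) := by
          rw [ENNReal.tsum_add, ENNReal.tsum_mul_left, hmeas]
      _ ≤ packPre q δ V + ENNReal.ofReal (2 * ε) * μ V := by
          rw [← hμV]
          gcongr
          exact subset_univ _
  have hlim : Tendsto (fun ε : ℝ => packPre q δ V + ENNReal.ofReal (2 * ε) * μ V) (𝓝[>] 0)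
      (𝓝 (packPre q δ V + ENNReal.ofReal (2 * 0) * μ V)) := by
    refine Tendsto.mono_left ?_ nhdsWithin_le_nhds
    refine tendsto_const_nhds.add (ENNReal.Tendsto.mul_const ?_ (Or.inr (hμ V hbdd).ne))
    exact ENNReal.tendsto_ofReal (tendsto_id.const_mul 2)
  have := ge_of_tendsto hlim (eventually_mem_nhdsWithin.mono hbound)
  simpa using this

/-- Packings of disjoint open subsets can be merged. -/
theorem packPre_add_le {X : Type*} [MetricSpace X] (q : X → ℝ → ℝ≥0∞) (δ : ℝ)
    {U V W : Set X} (hU : U ⊆ W) (hV : V ⊆ W) (hUV : Disjoint U V) :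
    packPre q δ U + packPre q δ V ≤ packPre q δ W := by
  have hempty : ∀ S : Set X, ∃ P, IsPackingOf S δ P := fun S => ⟨∅, by simp [IsPackingOf]⟩
  refine ENNReal.biSup_add_biSup_le' (hempty U) (hempty V) fun P hP Q hQ => ?_
  have hdisj : ∀ p ∈ P, ∀ p' ∈ Q, Disjoint (closedBall p.1 p.2) (closedBall p'.1 p'.2) :=
    fun p hp p' hp' => hUV.mono (hP.2.1 p hp).2.2 (hQ.2.1 p' hp').2.2
  have hPQ : Disjoint P Q := by
    refine Set.disjoint_left.2 fun p hp hp' => ?_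
    have h := hdisj p hp p hp'
    rw [disjoint_self, bot_eq_empty] at h
    exact (nonempty_closedBall.2 (hP.2.1 p hp).1.le).ne_empty h
  have hpack : IsPackingOf W δ (P ∪ Q) := by
    refine ⟨hP.1.union hQ.1, ?_, ?_⟩
    · rintro p (hp | hp)
      · exact ⟨(hP.2.1 p hp).1, (hP.2.1 p hp).2.1, (hP.2.1 p hp).2.2.trans hU⟩
      · exact ⟨(hQ.2.1 p hp).1, (hQ.2.1 p hp).2.1, (hQ.2.1 p hp).2.2.trans hV⟩
    · rintro p (hp | hp) p' (hp' | hp') hne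
      · exact hP.2.2 hp hp' hne
      · exact hdisj p hp p' hp'
      · exact (hdisj p' hp' p hp).symm
      · exact hQ.2.2 hp hp' hne
  have h := le_iSup₂ (f := fun (P : Set (X × ℝ)) (_ : IsPackingOf W δ P) =>
    ∑' p : P, q p.1.1 p.1.2) _ hpack
  rwa [ENNReal.summable.tsum_union_disjoint (f := fun p : X × ℝ => q p.1 p.2) hPQ
    ENNReal.summable] at h

theorem tsum_packPre_le {X : Type*} [MetricSpace X] (q : X → ℝ → ℝ≥0∞) (δ : ℝ)
    {V : ℕ → Set X} {W : Set X} (hV : ∀ n, V n ⊆ W) (hd : Pairwise (Function.onFun Disjoint V)) :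
    ∑' n, packPre q δ (V n) ≤ packPre q δ W := by
  have hfin : ∀ s : Finset ℕ, ∑ n ∈ s, packPre q δ (V n) ≤ packPre q δ (⋃ n ∈ s, V n) := by
    classical
    intro s
    induction s using Finset.induction_on with
    | empty => simp
    | insert n s hn ih =>
      rw [Finset.sum_insert hn, Finset.set_biUnion_insert]
      refine (add_le_add_right ih _).trans
        (packPre_add_le q δ subset_union_left subset_union_right ?_)
      refine Set.disjoint_iUnion₂_right.2 fun k hk => hd fun h => hn (h ▸ hk)
  rw [ENNReal.tsum_eq_iSup_sum]
  refine iSup_le fun s => (hfin s).trans ?_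
  have h := packPre_add_le q δ (iUnion₂_subset fun n (_ : n ∈ s) => hV n) (empty_subset W)
    (disjoint_empty _)
  exact le_self_add.trans h

/-- The sum of a premeasure dominated by `K • μ` over disjoint balls contained in `S` is at most
`K * μ S`. -/
theorem tsum_closedBall_le_mul_measure {X : Type*} [MetricSpace X] [MeasurableSpace X]
    [BorelSpace X] {μ : Measure X} {q : X → ℝ → ℝ≥0∞} {K : ℝ≥0∞}
    (hq : ∀ (x : X) (r : ℝ), 0 < r → q x r ≤ K * μ (closedBall x r))
    {P : Set (X × ℝ)} (hP : P.Countable) {S : Set X}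
    (hS : ∀ p ∈ P, 0 < p.2 ∧ closedBall p.1 p.2 ⊆ S)
    (hd : P.Pairwise fun p p' => Disjoint (closedBall p.1 p.2) (closedBall p'.1 p'.2)) :
    ∑' p : P, q p.1.1 p.1.2 ≤ K * μ S := by
  calc ∑' p : P, q p.1.1 p.1.2 ≤ ∑' p : P, K * μ (closedBall p.1.1 p.1.2) :=
        ENNReal.tsum_le_tsum fun p => hq _ _ (hS p p.2).1
    _ = K * μ (⋃ p ∈ P, closedBall p.1 p.2) := by
        rw [ENNReal.tsum_mul_left, measure_biUnion hP hd fun p _ =>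
          isClosed_closedBall.measurableSet]
    _ ≤ K * μ S := by
        gcongr
        exact iUnion₂_subset fun p hp => (hS p hp).2

theorem packOpen_le_mul_measure {X : Type*} [MetricSpace X] [MeasurableSpace X]
    [BorelSpace X] {μ : Measure X} {q : X → ℝ → ℝ≥0∞} {K : ℝ≥0∞}
    (hq : ∀ (x : X) (r : ℝ), 0 < r → q x r ≤ K * μ (closedBall x r)) (U : Set X) :
    packOpen q U ≤ K * μ U :=
  (iInf₂_le 1 one_pos).trans <| iSup₂_le fun _ hP =>
    tsum_closedBall_le_mul_measure hq hP.1 (fun p hp => ⟨(hP.2.1 p hp).1, (hP.2.1 p hp).2.2⟩) hP.2.2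

theorem packOpen_add_le {X : Type*} [MetricSpace X] (q : X → ℝ → ℝ≥0∞)
    {U V W : Set X} (hU : U ⊆ W) (hV : V ⊆ W) (hUV : Disjoint U V) :
    packOpen q U + packOpen q V ≤ packOpen q W :=
  le_iInf₂ fun δ hδ => (add_le_add (iInf₂_le δ hδ) (iInf₂_le δ hδ)).trans
    (packPre_add_le q δ hU hV hUV)

theorem mul_measure_le_packOpen {X : Type*} [MetricSpace X] [MeasurableSpace X]
    [BorelSpace X] [TopologicalSpace.SeparableSpace X] {ξ : ℝ} (hξ : 0 < ξ)
    {μ : Measure X} (hμ : ∀ s : Set X, IsBounded s → μ s < ⊤) {q : X → ℝ → ℝ≥0∞} {c : ℝ≥0∞}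
    (hsmall : ∀ V : Set X, IsOpen V → (∀ x ∈ V, ∀ y ∈ V, dist x y < ξ) → ∀ δ : ℝ, 0 < δ →
      c * μ V ≤ packPre q δ V)
    {U : Set X} (hU : IsOpen U) : c * μ U ≤ packOpen q U := by
  have : SecondCountableTopology X := UniformSpace.secondCountable_of_separable X
  have : IsLocallyFiniteMeasure μ := ⟨fun x => ⟨ball x 1, ball_mem_nhds x one_pos,
    hμ _ isBounded_ball⟩⟩
  refine le_iInf₂ fun δ hδ => ?_
  rcases isEmpty_or_nonempty X with hX | hX
  · simp [Set.eq_empty_of_isEmpty U]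
  have hρ : ∀ n : ℕ, ∃ ρ ∈ Ioo (ξ / 4) (ξ / 2),
      μ (frontier (thickening ρ {TopologicalSpace.denseSeq X n})) = 0 := fun n =>
    exists_null_frontier_thickening μ _ (by linarith)
  choose ρ hρ hρ0 using hρ
  set T : ℕ → Set X := fun n => thickening (ρ n) {TopologicalSpace.denseSeq X n} with hT
  have hTo : ∀ n, IsOpen (T n) := fun n => isOpen_thickening
  have hTcover : ∀ x : X, ∃ n, x ∈ closure (T n) := fun x => by
    obtain ⟨n, hn⟩ := (TopologicalSpace.denseRange_denseSeq X).exists_dist_lt x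
      (show 0 < ξ / 4 by linarith)
    refine ⟨n, subset_closure ?_⟩
    simp only [hT, thickening_singleton, mem_ball]
    exact hn.trans (hρ n).1
  set V : ℕ → Set X := fun n => (U ∩ T n) \ ⋃ k ∈ Finset.range n, closure (T k) with hV
  have hVo : ∀ n, IsOpen (V n) := fun n =>
    (hU.inter (hTo n)).sdiff (isClosed_biUnion_finset fun k _ => isClosed_closure)
  have hVdisj : ∀ i j, i < j → Disjoint (V i) (V j) := fun i j hij =>
    Set.disjoint_left.2 fun x hi hj => hj.2 <|
      mem_iUnion₂.2 ⟨i, Finset.mem_range.2 hij, subset_closure hi.1.2⟩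
  have hVd : Pairwise (Function.onFun Disjoint V) := fun i j hij => by
    rcases lt_or_gt_of_ne hij with h | h
    · exact hVdisj i j h
    · exact (hVdisj j i h).symm
  have hVsmall : ∀ n, ∀ x ∈ V n, ∀ y ∈ V n, dist x y < ξ := fun n x hx y hy => by
    have hx' := hx.1.2
    have hy' := hy.1.2
    simp only [hT, thickening_singleton, mem_ball] at hx' hy'
    have := dist_triangle_right x y (TopologicalSpace.denseSeq X n)
    linarith [(hρ n).2]
  have hcover : U ⊆ (⋃ n, V n) ∪ ⋃ n, frontier (T n) := by
    classical
    intro x hx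
    have hn := Nat.find_spec (hTcover x)
    have hmin : ∀ k < Nat.find (hTcover x), x ∉ closure (T k) := fun k hk =>
      Nat.find_min (hTcover x) hk
    by_cases hxT : x ∈ T (Nat.find (hTcover x))
    · refine Or.inl (mem_iUnion.2 ⟨Nat.find (hTcover x), ⟨hx, hxT⟩, fun h => ?_⟩)
      obtain ⟨k, hk, hxk⟩ := mem_iUnion₂.1 h
      exact hmin k (Finset.mem_range.1 hk) hxk
    · refine Or.inr (mem_iUnion.2 ⟨Nat.find (hTcover x), ?_⟩)
      rw [(hTo _).frontier_eq]
      exact ⟨hn, hxT⟩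
  have hle : μ U ≤ ∑' n, μ (V n) := by
    refine (measure_mono hcover).trans ((measure_union_le _ _).trans ?_)
    rw [measure_iUnion_null hρ0, add_zero]
    exact measure_iUnion_le _
  calc c * μ U ≤ ∑' n, c * μ (V n) := by
        rw [ENNReal.tsum_mul_left]
        gcongr
    _ ≤ ∑' n, packPre q δ (V n) :=
        ENNReal.tsum_le_tsum fun n => hsmall _ (hVo n) (hVsmall n) δ hδ
    _ ≤ packPre q δ U := tsum_packPre_le q δ (fun n _ hx => hx.1.1) hVd

theorem packPre_mono_scale {X : Type*} [MetricSpace X] (q : X → ℝ → ℝ≥0∞) (U : Set X) :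
    Monotone fun δ => packPre q δ U := fun _ _ h =>
  biSup_mono fun _ hP => ⟨hP.1, fun p hp => ⟨(hP.2.1 p hp).1, (hP.2.1 p hp).2.1.trans h,
    (hP.2.1 p hp).2.2⟩, hP.2.2⟩

theorem tendsto_packPre {X : Type*} [MetricSpace X] (q : X → ℝ → ℝ≥0∞) (U : Set X) :
    Tendsto (fun δ => packPre q δ U) (𝓝[>] 0) (𝓝 (packOpen q U)) := by
  have h := (packPre_mono_scale q U).tendsto_nhdsGT 0
  rwa [sInf_image] at h

/-- A packing of a union splits into packings of finitely many of the open sets, up to balls close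
to the complement of each of them. -/
theorem packPre_iUnion_le {X : Type*} [MetricSpace X] [MeasurableSpace X]
    [BorelSpace X] {μ : Measure X} {q : X → ℝ → ℝ≥0∞} {K : ℝ≥0∞}
    (hq : ∀ (x : X) (r : ℝ), 0 < r → q x r ≤ K * μ (closedBall x r))
    (U : ℕ → Set X) (N : ℕ) (δ : ℝ) :
    packPre q δ (⋃ n, U n) ≤ ∑ n ∈ Finset.range N, packPre q δ (U n) +
      K * μ ((⋃ n, U n) ∩ ⋂ n ∈ Finset.range N, cthickening (2 * δ) (U n)ᶜ) := by
  refine iSup₂_le fun P hP => ?_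
  set B := (⋃ n, U n) ∩ ⋂ n ∈ Finset.range N, cthickening (2 * δ) (U n)ᶜ
  let S : ℕ → Set (X × ℝ) := fun n => {p ∈ P | closedBall p.1 p.2 ⊆ U n}
  let Q : Set (X × ℝ) := {p ∈ P | closedBall p.1 p.2 ⊆ B}
  have hsub : P ⊆ (⋃ n ∈ Finset.range N, S n) ∪ Q := by
    intro p hp
    by_cases h : ∃ n ∈ Finset.range N, closedBall p.1 p.2 ⊆ U n
    · obtain ⟨n, hn, hpn⟩ := h
      exact Or.inl (mem_iUnion₂.2 ⟨n, hn, hp, hpn⟩)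
    · push Not at h
      refine Or.inr ⟨hp, fun x hx => ⟨(hP.2.1 p hp).2.2 hx, mem_iInter₂.2 fun n hn => ?_⟩⟩
      obtain ⟨y, hy, hyU⟩ := not_subset.1 (h n hn)
      refine mem_cthickening_of_dist_le x y _ _ hyU ?_
      rw [mem_closedBall] at hx hy
      have := dist_triangle_right x y p.1
      linarith [(hP.2.1 p hp).2.1]
  have hS : ∀ n, IsPackingOf (U n) δ (S n) := fun n =>
    ⟨hP.1.mono (sep_subset _ _), fun p hp => ⟨(hP.2.1 p hp.1).1, (hP.2.1 p hp.1).2.1, hp.2⟩,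
      hP.2.2.mono (sep_subset _ _)⟩
  let f : X × ℝ → ℝ≥0∞ := fun p => q p.1 p.2
  calc ∑' p : P, f p ≤ ∑' p : ↑((⋃ n ∈ Finset.range N, S n) ∪ Q), f p :=
        ENNReal.tsum_mono_subtype f hsub
    _ ≤ ∑ n ∈ Finset.range N, ∑' p : S n, f p + ∑' p : Q, f p :=
        (ENNReal.tsum_union_le f _ _).trans (add_le_add_left (ENNReal.tsum_biUnion_le f _ _) _)
    _ ≤ _ := by
        refine add_le_add (Finset.sum_le_sum fun n _ => ?_) ?_
        · exact le_iSup₂ (f := fun (P : Set (X × ℝ)) (_ : IsPackingOf (U n) δ P) =>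
            ∑' p : P, q p.1.1 p.1.2) _ (hS n)
        · exact tsum_closedBall_le_mul_measure hq (hP.1.mono (sep_subset _ _))
            (fun p hp => ⟨(hP.2.1 p hp.1).1, hp.2⟩) (hP.2.2.mono (sep_subset _ _))

theorem packOpen_iUnion_le_of_measure_ne_top {X : Type*} [MetricSpace X] [MeasurableSpace X]
    [BorelSpace X] {μ : Measure X} {q : X → ℝ → ℝ≥0∞} {K : ℝ≥0∞} (hK : K ≠ ⊤)
    (hq : ∀ (x : X) (r : ℝ), 0 < r → q x r ≤ K * μ (closedBall x r))
    {U : ℕ → Set X} (hU : ∀ n, IsOpen (U n)) (hfin : μ (⋃ n, U n) ≠ ⊤) :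
    packOpen q (⋃ n, U n) ≤ ∑' n, packOpen q (U n) := by
  have hmeas : MeasurableSet (⋃ n, U n) := (isOpen_iUnion hU).measurableSet
  have hN : ∀ N : ℕ, packOpen q (⋃ n, U n) ≤ ∑ n ∈ Finset.range N, packOpen q (U n) +
      K * μ ((⋃ n, U n) \ ⋃ n ∈ Finset.range N, U n) := by
    intro N
    set B : ℝ → Set X := fun δ =>
      (⋃ n, U n) ∩ ⋂ n ∈ Finset.range N, cthickening (2 * δ) (U n)ᶜ with hB
    have hBlim : Tendsto (μ ∘ B) (𝓝[>] 0) (𝓝 (μ (⋂ δ > (0 : ℝ), B δ))) := by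
      refine tendsto_measure_biInter_gt (fun δ _ => ?_) (fun i j _ hij => ?_) ⟨1, one_pos, ?_⟩
      · exact (hmeas.inter (Finset.measurableSet_biInter _ fun n _ =>
          isClosed_cthickening.measurableSet)).nullMeasurableSet
      · exact inter_subset_inter_right _ (iInter₂_mono fun n _ =>
          cthickening_mono (by linarith) _)
      · exact measure_ne_top_of_subset inter_subset_left hfin
    have hBsub : ⋂ δ > (0 : ℝ), B δ ⊆ (⋃ n, U n) \ ⋃ n ∈ Finset.range N, U n := by
      intro x hx
      rw [mem_iInter₂] at hx
      refine ⟨(hx 1 one_pos).1, fun h => ?_⟩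
      obtain ⟨n, hn, hxn⟩ := mem_iUnion₂.1 h
      have hcl : x ∈ closure (U n)ᶜ := by
        rw [closure_eq_iInter_cthickening]
        refine mem_iInter₂.2 fun δ hδ => ?_
        have := mem_iInter₂.1 (hx (δ / 2) (half_pos hδ)).2 n hn
        rwa [mul_div_cancel₀ δ two_ne_zero] at this
      rw [(hU n).isClosed_compl.closure_eq] at hcl
      exact hcl hxn
    have hlim : Tendsto (fun δ => ∑ n ∈ Finset.range N, packPre q δ (U n) + K * μ (B δ)) (𝓝[>] 0)
        (𝓝 (∑ n ∈ Finset.range N, packOpen q (U n) + K * μ (⋂ δ > (0 : ℝ), B δ))) :=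
      (tendsto_finsetSum _ fun n _ => tendsto_packPre q (U n)).add
        (ENNReal.Tendsto.const_mul hBlim (Or.inr hK))
    refine (le_of_tendsto_of_tendsto' (tendsto_packPre q _) hlim fun δ =>
      packPre_iUnion_le hq U N δ).trans ?_
    gcongr
  have hanti : Antitone fun N => (⋃ n, U n) \ ⋃ n ∈ Finset.range N, U n := fun i j hij =>
    sdiff_subset_sdiff_right (biUnion_subset_biUnion_left (Finset.range_mono hij))
  have hempty : ⋂ N : ℕ, ((⋃ n, U n) \ ⋃ n ∈ Finset.range N, U n) = ∅ := by
    refine eq_empty_of_forall_notMem fun x hx => ?_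
    rw [mem_iInter] at hx
    obtain ⟨n, hn⟩ := mem_iUnion.1 (hx 0).1
    exact (hx (n + 1)).2 (mem_iUnion₂.2 ⟨n, Finset.self_mem_range_succ n, hn⟩)
  have htail : Tendsto (fun N => μ ((⋃ n, U n) \ ⋃ n ∈ Finset.range N, U n)) atTop (𝓝 0) := by
    have := tendsto_measure_iInter_atTop (μ := μ) (fun N => (hmeas.diff
      (Finset.measurableSet_biUnion (Finset.range N)
        fun n _ => (hU n).measurableSet)).nullMeasurableSet) hanti
      ⟨0, measure_ne_top_of_subset sdiff_subset hfin⟩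
    rwa [hempty, measure_empty] at this
  have hlim := ((ENNReal.tendsto_nat_tsum fun n => packOpen q (U n)).add
    (ENNReal.Tendsto.const_mul htail (Or.inr hK)))
  rw [mul_zero, add_zero] at hlim
  exact ge_of_tendsto' hlim hN

theorem packM_mono {X : Type*} [MetricSpace X] (q : X → ℝ → ℝ≥0∞) {A B : Set X} (h : A ⊆ B) :
    packM q A ≤ packM q B :=
  le_iInf₂ fun U hU => le_iInf fun hB => iInf₂_le_of_le U hU (iInf_le _ (h.trans hB))

theorem packM_le_packOpen {X : Type*} [MetricSpace X] (q : X → ℝ → ℝ≥0∞) {A U : Set X}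
    (hU : IsOpen U) (h : A ⊆ U) : packM q A ≤ packOpen q U :=
  iInf₂_le_of_le U hU (iInf_le _ h)

theorem packM_union_of_le_dist {X : Type*} [MetricSpace X] {q : X → ℝ → ℝ≥0∞}
    (hsub : ∀ E F : Set X, packM q (E ∪ F) ≤ packM q E + packM q F)
    {E F : Set X} {ε : ℝ} (hε : 0 < ε) (hEF : ∀ x ∈ E, ∀ y ∈ F, ε ≤ dist x y) :
    packM q (E ∪ F) = packM q E + packM q F := by
  refine le_antisymm (hsub E F) (le_iInf₂ fun U hU => le_iInf fun h => ?_)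
  have hd : Disjoint (thickening (ε / 2) E) (thickening (ε / 2) F) := by
    refine Set.disjoint_left.2 fun z hzE hzF => ?_
    obtain ⟨x, hx, hzx⟩ := mem_thickening_iff.1 hzE
    obtain ⟨y, hy, hzy⟩ := mem_thickening_iff.1 hzF
    have := dist_triangle_left x y z
    linarith [hEF x hx y hy]
  have h2 : 0 < ε / 2 := half_pos hε
  calc packM q E + packM q F
      ≤ packOpen q (U ∩ thickening (ε / 2) E) + packOpen q (U ∩ thickening (ε / 2) F) := by
        refine add_le_add (packM_le_packOpen q (hU.inter isOpen_thickening) ?_)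
          (packM_le_packOpen q (hU.inter isOpen_thickening) ?_)
        · exact subset_inter (subset_union_left.trans h) (self_subset_thickening h2 E)
        · exact subset_inter (subset_union_right.trans h) (self_subset_thickening h2 F)
    _ ≤ packOpen q U := packOpen_add_le q inter_subset_left inter_subset_left
        (hd.mono inter_subset_right inter_subset_right)

theorem packM_iUnion_le {X : Type*} [MetricSpace X] {q : X → ℝ → ℝ≥0∞}
    (hsub : ∀ U : ℕ → Set X, (∀ n, IsOpen (U n)) →
      packOpen q (⋃ n, U n) ≤ ∑' n, packOpen q (U n)) (A : ℕ → Set X) :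
    packM q (⋃ n, A n) ≤ ∑' n, packM q (A n) := by
  refine ENNReal.le_of_forall_pos_le_add fun ε hε hfin => ?_
  obtain ⟨e, he, hsum⟩ := ENNReal.exists_pos_sum_of_countable (ENNReal.coe_pos.2 hε).ne' ℕ
  have hU : ∀ n, ∃ U, IsOpen U ∧ A n ⊆ U ∧ packOpen q U < packM q (A n) + e n := fun n => by
    have hlt : packM q (A n) < packM q (A n) + e n :=
      ENNReal.lt_add_right (ne_top_of_le_ne_top hfin.ne (ENNReal.le_tsum n))
        (ENNReal.coe_pos.2 (he n)).ne'
    conv_lhs at hlt => rw [packM]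
    simpa only [iInf_lt_iff, exists_prop] using hlt
  choose U hUo hAU hlt using hU
  calc packM q (⋃ n, A n) ≤ packOpen q (⋃ n, U n) :=
        packM_le_packOpen q (isOpen_iUnion hUo) (iUnion_mono hAU)
    _ ≤ ∑' n, packOpen q (U n) := hsub U hUo
    _ ≤ ∑' n, (packM q (A n) + e n) := ENNReal.tsum_le_tsum fun n => (hlt n).le
    _ ≤ ∑' n, packM q (A n) + ε := by
        rw [ENNReal.tsum_add]
        gcongr

theorem packM_isMetricOuterMeasure_and_comparable {X : Type*} [MetricSpace X] [MeasurableSpace X]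
    [BorelSpace X] [TopologicalSpace.SeparableSpace X] {ξ η : ℝ} {ζ : ℕ} (hξ : 0 < ξ)
    (hη : η ≤ 1 / 3) (hdir : DirLimited (univ : Set X) ξ η ζ) {ν μ m : Measure X} {α γ C : ℝ}
    (hα : 0 < α) (hα1 : α ≤ 1) (hγ : 1 ≤ γ) (hC : 1 ≤ C) (hν : AsympBounded ν α γ)
    (hsing : m.MutuallySingular μ)
    (hμ : ∀ s : Set X, IsBounded s → μ s < ⊤) (hm : ∀ s : Set X, IsBounded s → m s < ⊤)
    {q : X → ℝ → ℝ≥0∞}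
    (hq₁ : ∀ (x : X) (r : ℝ), 0 < r →
      ENNReal.ofReal (1 / C) * μ (closedBall x (α * r)) ≤ q x r + m (closedBall x r))
    (hq₂ : ∀ (x : X) (r : ℝ), 0 < r → q x r ≤ ENNReal.ofReal C * μ (closedBall x r)) :
    (packM q (∅ : Set X) = 0 ∧
      (∀ A B : Set X, A ⊆ B → packM q A ≤ packM q B) ∧
      (∀ A : ℕ → Set X, packM q (⋃ n, A n) ≤ ∑' n, packM q (A n)) ∧
      (∀ E F : Set X, (∃ ε : ℝ, 0 < ε ∧ ∀ x ∈ E, ∀ y ∈ F, ε ≤ dist x y) →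
        packM q (E ∪ F) = packM q E + packM q F) ∧
      (∀ s : Set X, IsBounded s → packM q s < ⊤)) ∧
    ∀ A : Set X, MeasurableSet A →
      ENNReal.ofReal (1 / (γ * C)) * μ A ≤ packM q A ∧ packM q A ≤ ENNReal.ofReal C * μ A := by
  have : SecondCountableTopology X := UniformSpace.secondCountable_of_separable X
  have : IsLocallyFiniteMeasure μ := ⟨fun x => ⟨ball x 1, ball_mem_nhds x one_pos,
    hμ _ isBounded_ball⟩⟩
  set c := ENNReal.ofReal (1 / (γ * C)) with hc
  have hc0 : c ≠ 0 := (ENNReal.ofReal_pos.2 (by positivity)).ne'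
  have hlow : ∀ U : Set X, IsOpen U → c * μ U ≤ packOpen q U := fun U hU =>
    mul_measure_le_packOpen hξ hμ (fun V hVo hV δ hδ => mul_measure_le_packPre_of_dist_lt hη hdir
      hα hα1 hγ hC hν hsing hμ hm hq₁ hVo hV hδ) hU
  have hup : ∀ U : Set X, IsOpen U → packM q U ≤ ENNReal.ofReal C * μ U := fun U hU =>
    (packM_le_packOpen q hU subset_rfl).trans (packOpen_le_mul_measure hq₂ U)
  have hopen : ∀ U : ℕ → Set X, (∀ n, IsOpen (U n)) →
      packOpen q (⋃ n, U n) ≤ ∑' n, packOpen q (U n) := by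
    intro U hU
    by_cases htop : ∑' n, packOpen q (U n) = ⊤
    · simp [htop]
    refine packOpen_iUnion_le_of_measure_ne_top ENNReal.ofReal_ne_top hq₂ hU fun h => htop ?_
    have hle : c * μ (⋃ n, U n) ≤ ∑' n, packOpen q (U n) := by
      calc c * μ (⋃ n, U n) ≤ ∑' n, c * μ (U n) := by
            rw [ENNReal.tsum_mul_left]
            gcongr
            exact measure_iUnion_le _
        _ ≤ _ := ENNReal.tsum_le_tsum fun n => hlow _ (hU n)
    rwa [h, ENNReal.mul_top hc0, top_le_iff] at hle
  have hempty : packM q (∅ : Set X) = 0 := by simpa using hup ∅ isOpen_empty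
  have hiUnion := packM_iUnion_le hopen
  have hunion : ∀ E F : Set X, packM q (E ∪ F) ≤ packM q E + packM q F := by
    let ω : OuterMeasure X :=
      { measureOf := packM q
        empty := hempty
        mono := fun h => packM_mono q h
        iUnion_nat := fun A _ => hiUnion A }
    exact fun E F => measure_union_le (μ := ω) E F
  refine ⟨⟨hempty, fun A B => packM_mono q, hiUnion, ?_, fun s hs => ?_⟩, fun A _ => ⟨?_, ?_⟩⟩
  · rintro E F ⟨ε, hε, hEF⟩
    exact packM_union_of_le_dist hunion hε hEF
  · rcases s.eq_empty_or_nonempty with rfl | ⟨x, hx⟩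
    · simp [hempty]
    obtain ⟨R, hR⟩ := hs.subset_ball x
    exact ((packM_mono q hR).trans (hup _ isOpen_ball)).trans_lt
      (ENNReal.mul_lt_top ENNReal.ofReal_lt_top (hμ _ isBounded_ball))
  · refine le_iInf₂ fun U hU => le_iInf fun hAU => le_trans ?_ (hlow U hU)
    gcongr
  · rw [A.measure_eq_iInf_isOpen μ]
    have hC0 : ENNReal.ofReal C ≠ 0 := (ENNReal.ofReal_pos.2 (by linarith)).ne'
    simp only [ENNReal.mul_iInf_of_ne hC0 ENNReal.ofReal_ne_top]
    exact le_iInf₂ fun U hAU => le_iInf fun hU => (packM_mono q hAU).trans (hup U hU)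

/-- signed case: under Hypothesis 1, for a signed measure `μ = μ⁺ − μ⁻` with
mutually singular parts finite on bounded sets, and premeasures `q₊, q₋` satisfying
`C⁻¹ μ⁺(B_{αr}(x)) − μ⁻(B_r(x)) ≤ q₊(B_r(x)) ≤ C μ⁺(B_r(x))` (stated additively) and the
symmetric bounds for `q₋`: (i) `ĥμ^{q₊}`, `ĥμ^{q₋}` are metric outer measures finite on
bounded sets; (ii) `(1/(γC)) μ^± ≤ ĥμ^{q_±} ≤ C μ^±` on Borel sets, and consequently the
total variations are comparable. -/
theorem stmt18 {X : Type*} [MetricSpace X] [MeasurableSpace X] [BorelSpace X]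
    [TopologicalSpace.SeparableSpace X]
    (ξ η : ℝ) (ζ : ℕ) (hξ : 0 < ξ) (hη : 0 < η) (hη' : η ≤ 1/3) (hζ : 0 < ζ)
    (hdir : DirLimited (Set.univ : Set X) ξ η ζ)
    (ν : Measure X) (α γ : ℝ) (hα : 0 < α) (hα1 : α ≤ 1) (hγ : 1 ≤ γ)
    (hν : AsympBounded ν α γ)
    (μp μm : Measure X) (hsing : μp.MutuallySingular μm)
    (hfp : ∀ s : Set X, Bornology.IsBounded s → μp s < ⊤)
    (hfm : ∀ s : Set X, Bornology.IsBounded s → μm s < ⊤)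
    (qp qm : X → ℝ → ℝ≥0∞) (C : ℝ) (hC : 1 ≤ C)
    (hqp₁ : ∀ (x : X) (r : ℝ), 0 < r →
      ENNReal.ofReal (1 / C) * μp (Metric.closedBall x (α * r)) ≤
        qp x r + μm (Metric.closedBall x r))
    (hqp₂ : ∀ (x : X) (r : ℝ), 0 < r →
      qp x r ≤ ENNReal.ofReal C * μp (Metric.closedBall x r))
    (hqm₁ : ∀ (x : X) (r : ℝ), 0 < r →
      ENNReal.ofReal (1 / C) * μm (Metric.closedBall x (α * r)) ≤
        qm x r + μp (Metric.closedBall x r))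
    (hqm₂ : ∀ (x : X) (r : ℝ), 0 < r →
      qm x r ≤ ENNReal.ofReal C * μm (Metric.closedBall x r)) :
    -- (i) ĥμ^{q₊} and ĥμ^{q₋} are metric outer measures, finite on bounded sets
    (packM qp (∅ : Set X) = 0 ∧
      (∀ A B : Set X, A ⊆ B → packM qp A ≤ packM qp B) ∧
      (∀ A : ℕ → Set X, packM qp (⋃ n, A n) ≤ ∑' n, packM qp (A n)) ∧
      (∀ E F : Set X, (∃ ε : ℝ, 0 < ε ∧ ∀ x ∈ E, ∀ y ∈ F, ε ≤ dist x y) →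
        packM qp (E ∪ F) = packM qp E + packM qp F) ∧
      (∀ s : Set X, Bornology.IsBounded s → packM qp s < ⊤)) ∧
    (packM qm (∅ : Set X) = 0 ∧
      (∀ A B : Set X, A ⊆ B → packM qm A ≤ packM qm B) ∧
      (∀ A : ℕ → Set X, packM qm (⋃ n, A n) ≤ ∑' n, packM qm (A n)) ∧
      (∀ E F : Set X, (∃ ε : ℝ, 0 < ε ∧ ∀ x ∈ E, ∀ y ∈ F, ε ≤ dist x y) →
        packM qm (E ∪ F) = packM qm E + packM qm F) ∧
      (∀ s : Set X, Bornology.IsBounded s → packM qm s < ⊤)) ∧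
    -- (ii) two-sided comparison with μ⁺ and μ⁻, hence with the total variation
    (∀ A : Set X, MeasurableSet A →
      (ENNReal.ofReal (1 / (γ * C)) * μp A ≤ packM qp A ∧
        packM qp A ≤ ENNReal.ofReal C * μp A) ∧
      (ENNReal.ofReal (1 / (γ * C)) * μm A ≤ packM qm A ∧
        packM qm A ≤ ENNReal.ofReal C * μm A) ∧
      (ENNReal.ofReal (1 / (γ * C)) * (μp A + μm A) ≤ packM qp A + packM qm A ∧
        packM qp A + packM qm A ≤ ENNReal.ofReal C * (μp A + μm A))) := by
  obtain ⟨hp, hp'⟩ := packM_isMetricOuterMeasure_and_comparable hξ hη' hdir hα hα1 hγ hC hν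
    hsing.symm hfp hfm hqp₁ hqp₂
  obtain ⟨hm, hm'⟩ := packM_isMetricOuterMeasure_and_comparable hξ hη' hdir hα hα1 hγ hC hν
    hsing hfm hfp hqm₁ hqm₂
  refine ⟨hp, hm, fun A hA => ⟨hp' A hA, hm' A hA, ?_, ?_⟩⟩
  · rw [mul_add]
    exact add_le_add (hp' A hA).1 (hm' A hA).1
  · rw [mul_add]
    exact add_le_add (hp' A hA).2 (hm' A hA).2
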